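/- arXiv:math/0204210 — 2 statements merged into one kernel-verified Lean document; each statement's English description precedes it below -/
import Mathlib

section
/- Let G = H_1 × ⋯ × H_r be a finite abelian group written as a direct product of cyclic groups H_i of order n_i with fixed generators τ_i, let e be the exponent of G, let R be a commutative ring containing an element ζ that is a root of the e-th cyclotomic polynomial Φ_e over ℤ, and let M be a finite R[G]-module. For 0 ≤ i ≤ r-1 set G_i = H_1 × ⋯ × H_i (with G_0 the trivial group). Then [M] · ∏_{i=1}^{r} ∏_{χ ∈ Ĥ_i} ∏_{ψ ∈ Ĝ_{i-1}} [Ĥ⁰_χ(H_i, M^ψ) / S_χ(M^ψ)] = ∏_{χ ∈ Ĝ} [M^χ]. -/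
noncomputable section

open Polynomial

variable {R : Type*} [CommRing R] {M : Type*} [AddCommGroup M] [Module R M]

/-- The quasi-idempotent `ε_χ = ∑_{j<m} ξ^{-kj} τ^j` of a cyclic group of order `m` whose
generator `τ` acts via the endomorphism `U`, for the character `χ(τ) = ξ^k`
(here `ξ⁻¹ = ξ^{m-1}` since `ξ^m = 1`). -/
def quasiIdem (U : Module.End R M) (ξ : R) (m k : ℕ) : Module.End R M :=
  ∑ j ∈ Finset.range m, ξ ^ ((m - 1) * (k * j)) • U ^ j

/-- The product `∏_{j=k+1}^{m-1} (τ - ξ^j)` acting via `U`. -/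
def tailProd (U : Module.End R M) (ξ : R) (m k : ℕ) : Module.End R M :=
  Polynomial.aeval U (∏ j ∈ Finset.Ico (k + 1) m, (X - C (ξ ^ j)))

/-- The isotypic component `N^χ = {m ∈ N : τ m = ξ^k m}` of a submodule `N` on which a cyclic
group acts through `U`. -/
def isoIn (N : Submodule R M) (U : Module.End R M) (ξ : R) (k : ℕ) : Submodule R M :=
  N ⊓ LinearMap.ker (U - ξ ^ k • (1 : Module.End R M))

/-- `Ĥ⁰_χ(H, N) = N^χ / ε_χ N` for the cyclic group `H` of order `m` acting on `N` via `U`,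
with character `χ(τ) = ξ^k`. -/
abbrev H0rel (N : Submodule R M) (U : Module.End R M) (ξ : R) (m k : ℕ) :=
  ↥(isoIn N U ξ k) ⧸
    Submodule.comap (isoIn N U ξ k).subtype (Submodule.map (quasiIdem U ξ m k) N)

/-- `S_χ(N) = (N^χ ∩ (∏_{j=k+1}^{m-1}(τ - ξ^j)) N) / ε_χ N`, a submodule of `Ĥ⁰_χ(H,N)`. -/
def Srel (N : Submodule R M) (U : Module.End R M) (ξ : R) (m k : ℕ) :
    Submodule R (H0rel N U ξ m k) :=
  Submodule.map
    (Submodule.mkQ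
      (Submodule.comap (isoIn N U ξ k).subtype (Submodule.map (quasiIdem U ξ m k) N)))
    (Submodule.comap (isoIn N U ξ k).subtype (Submodule.map (tailProd U ξ m k) N))

/-- The fixed module `M^ψ` of the character `ψ` of `G_s = H_1 × ⋯ × H_s`, where the generator
`τ_t` of `H_t` (of order `n t`) acts via `T t` and `ψ(τ_t) = (ζ^{e/n_t})^{k t}`:
`M^ψ = {m : T t m = ζ^{(e/n_t)·k_t} m for all t < s}`. -/
def psiFix {r : ℕ} (n : Fin r → ℕ) (T : Fin r → Module.End R M) (ζ : R) (e : ℕ)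
    (k : ∀ t, Fin (n t)) (s : ℕ) : Submodule R M :=
  ⨅ (t : Fin r) (_ : (t : ℕ) < s),
    LinearMap.ker (T t - ζ ^ (e / n t * (k t : ℕ)) • (1 : Module.End R M))

theorem Submodule.card_map_mul_card_inf_ker [Finite M] (L : Module.End R M) (P : Submodule R M) :
    Nat.card (P.map L) * Nat.card (P ⊓ LinearMap.ker L : Submodule R M) = Nat.card P := by
  rw [← Submodule.map_comap_subtype, ← Nat.card_congr (Submodule.equivMapOfInjective P.subtype
    P.injective_subtype (Submodule.comap P.subtype (LinearMap.ker L))).toEquiv,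
    ← LinearMap.range_domRestrict, ← LinearMap.ker_domRestrict,
    Submodule.card_eq_card_quotient_mul_card (LinearMap.ker (L.domRestrict P)), mul_comm,
    Nat.card_congr (L.domRestrict P).quotKerEquivRange.toEquiv]

theorem Submodule.card_quotient_comap_subtype_mul_card_inf [Finite M] (P Q : Submodule R M) :
    Nat.card (P ⧸ Q.comap P.subtype) * Nat.card (P ⊓ Q : Submodule R M) = Nat.card P := by
  rw [← Submodule.map_comap_subtype, ← Nat.card_congr (Submodule.equivMapOfInjective P.subtype
    P.injective_subtype (Submodule.comap P.subtype Q)).toEquiv,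
    Submodule.card_eq_card_quotient_mul_card (Q.comap P.subtype), mul_comm]

theorem Submodule.map_aeval_le {N : Submodule R M} {U : Module.End R M} (hN : N.map U ≤ N)
    (p : R[X]) : N.map (aeval U p) ≤ N := by
  have hpow (j : ℕ) (x : M) (hx : x ∈ N) : (U ^ j) x ∈ N := by
    induction j with
    | zero => simpa using hx
    | succ j ih =>
      rw [pow_succ']
      exact hN (Submodule.mem_map_of_mem ih)
  rintro _ ⟨x, hx, rfl⟩
  rw [aeval_eq_sum_range, LinearMap.sum_apply]
  exact N.sum_mem fun j _ => N.smul_mem _ (hpow j x hx)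

theorem Polynomial.X_pow_sub_one_eq_prod_range_of_aeval_cyclotomic {R : Type*} [CommRing R]
    {e : ℕ} (he : 0 < e) {ζ : R} (hζ : aeval ζ (cyclotomic e ℤ) = 0) {m : ℕ} (hm : m ∣ e) :
    (X ^ m - 1 : R[X]) = ∏ j ∈ Finset.range m, (X - C ((ζ ^ (e / m)) ^ j)) := by
  have hirr := cyclotomic.irreducible he
  have : IsDomain (AdjoinRoot (cyclotomic e ℤ)) :=
    AdjoinRoot.isDomain_of_prime hirr.prime
  have hinj : Function.Injective (algebraMap ℤ (AdjoinRoot (cyclotomic e ℤ))) :=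
    AdjoinRoot.of.injective_of_degree_ne_zero (degree_cyclotomic_pos e ℤ he).ne'
  have : CharZero (AdjoinRoot (cyclotomic e ℤ)) := charZero_of_injective_algebraMap hinj
  have : NeZero (e : AdjoinRoot (cyclotomic e ℤ)) := ⟨by exact_mod_cast he.ne'⟩
  have hroot : IsPrimitiveRoot (AdjoinRoot.root (cyclotomic e ℤ)) e := by
    rw [← isRoot_cyclotomic_iff]
    have h := AdjoinRoot.isRoot_root (cyclotomic e ℤ)
    rwa [map_cyclotomic] at h
  have hm0 : 0 < m := Nat.pos_of_dvd_of_pos hm he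
  have hprim := hroot.pow he (Nat.div_mul_cancel hm).symm
  have key := X_pow_sub_one_eq_prod hm0 hprim
  rw [nthRootsFinset, ← Multiset.toFinset_eq hprim.nthRoots_one_nodup, Finset.prod_mk,
    hprim.nthRoots_eq (one_pow m), Multiset.map_map, ← Finset.range_val, ← Finset.prod] at key
  have hlift : eval₂ (Int.castRingHom R) ζ (cyclotomic e ℤ) = 0 := hζ
  simpa [Polynomial.map_prod, AdjoinRoot.lift_root hlift] using
    congrArg (Polynomial.map (AdjoinRoot.lift (Int.castRingHom R) ζ hlift)) key

section Cyclic

variable {U : Module.End R M} {ξ : R} {m : ℕ} {N : Submodule R M}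

theorem exists_quasiIdem_eq_aeval_prod_mul
    (hprod : (X ^ m - 1 : R[X]) = ∏ j ∈ Finset.range m, (X - C (ξ ^ j))) {c : ℕ} (hc : c < m) :
    ∃ p : R[X],
      quasiIdem U ξ m c = aeval U ((∏ j ∈ Finset.Ico (c + 1) m, (X - C (ξ ^ j))) * p) := by
  set y := ξ ^ c with hy
  have hym : y ^ m = 1 := by
    have h := congrArg (eval y) hprod
    rw [eval_prod, Finset.prod_eq_zero (Finset.mem_range.mpr hc) (by simp [hy])] at h
    simpa [sub_eq_zero] using h
  have hcoeff (j : ℕ) (hj : j < m) : ξ ^ ((m - 1) * (c * j)) = y * y ^ (m - 1 - j) := by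
    have hunit : IsUnit (y ^ j) := (IsUnit.of_pow_eq_one hym (by omega)).pow j
    refine hunit.mul_right_cancel ?_
    obtain ⟨l, rfl⟩ : ∃ l, m = j + l + 1 := ⟨m - j - 1, by omega⟩
    have h₁ : ξ ^ ((j + l + 1 - 1) * (c * j)) * y ^ j = (y ^ (j + l + 1)) ^ j := by
      rw [hy, Nat.add_sub_cancel]
      ring
    have h₂ : y * y ^ (j + l + 1 - 1 - j) * y ^ j = y ^ (j + l + 1) := by
      rw [show j + l + 1 - 1 - j = l by omega]
      ring
    rw [h₁, h₂, hym, one_pow]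
  have hgeom : ∑ j ∈ Finset.range m, X ^ j * (C y) ^ (m - 1 - j) =
      (∏ j ∈ Finset.Ico (c + 1) m, (X - C (ξ ^ j))) * ∏ j ∈ Finset.range c, (X - C (ξ ^ j)) := by
    refine (monic_X_sub_C y).isRegular.right.eq_iff.mp ?_
    rw [geom_sum₂_mul, ← C_pow, hym, C_1, hprod, Finset.range_eq_Ico,
      ← Finset.prod_Ico_consecutive _ (Nat.zero_le c) hc.le, Finset.prod_eq_prod_Ico_succ_bot hc,
      Finset.range_eq_Ico]
    ring
  refine ⟨(∏ j ∈ Finset.range c, (X - C (ξ ^ j))) * C y, ?_⟩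
  rw [← mul_assoc, ← hgeom, quasiIdem, Finset.sum_mul, map_sum]
  refine Finset.sum_congr rfl fun j hj => ?_
  rw [hcoeff j (Finset.mem_range.mp hj), mul_assoc, ← C_pow, ← C_mul, mul_comm y, mul_comm (X ^ j),
    ← smul_eq_C_mul, map_smul, map_pow, aeval_X]

theorem map_quasiIdem_le_map_tailProd
    (hprod : (X ^ m - 1 : R[X]) = ∏ j ∈ Finset.range m, (X - C (ξ ^ j)))
    (hN : N.map U ≤ N) {c : ℕ} (hc : c < m) :
    N.map (quasiIdem U ξ m c) ≤ N.map (tailProd U ξ m c) := by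
  obtain ⟨p, hp⟩ := exists_quasiIdem_eq_aeval_prod_mul (U := U) hprod hc
  rw [hp, map_mul, Module.End.mul_eq_comp, Submodule.map_comp]
  exact Submodule.map_mono (Submodule.map_aeval_le hN p)

theorem card_H0rel_quotient_Srel_mul_card [Finite M] {c : ℕ}
    (h : N.map (quasiIdem U ξ m c) ≤ N.map (tailProd U ξ m c)) :
    Nat.card (H0rel N U ξ m c ⧸ Srel N U ξ m c) *
      Nat.card (isoIn N U ξ c ⊓ N.map (tailProd U ξ m c) : Submodule R M) =
        Nat.card (isoIn N U ξ c) := by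
  rw [← Submodule.card_quotient_comap_subtype_mul_card_inf (isoIn N U ξ c)
    (N.map (tailProd U ξ m c))]
  congr 1
  exact Nat.card_congr
    (Submodule.quotientQuotientEquivQuotient
      ((N.map (quasiIdem U ξ m c)).comap (isoIn N U ξ c).subtype)
      ((N.map (tailProd U ξ m c)).comap (isoIn N U ξ c).subtype) (Submodule.comap_mono h)).toEquiv

theorem card_map_tailProd [Finite M] (hN : N.map U ≤ N) {c : ℕ} (hc : c < m) :
    Nat.card (N.map (tailProd U ξ m c)) =
      Nat.card (N.map (aeval U (∏ j ∈ Finset.Ico c m, (X - C (ξ ^ j))))) *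
        Nat.card (isoIn N U ξ c ⊓ N.map (tailProd U ξ m c) : Submodule R M) := by
  have hL : aeval U (X - C (ξ ^ c)) = U - ξ ^ c • (1 : Module.End R M) := by
    rw [map_sub, aeval_X, aeval_C, Algebra.algebraMap_eq_smul_one]
  have hle : N.map (tailProd U ξ m c) ≤ N := Submodule.map_aeval_le hN _
  rw [← Submodule.card_map_mul_card_inf_ker (U - ξ ^ c • 1) (N.map (tailProd U ξ m c)),
    Finset.prod_eq_prod_Ico_succ_bot hc, map_mul, hL, Module.End.mul_eq_comp, Submodule.map_comp]
  congr 2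
  rw [isoIn, inf_right_comm, inf_eq_right.mpr hle]

theorem card_mul_prod_card_H0rel_quotient_Srel [Finite M]
    (hprod : (X ^ m - 1 : R[X]) = ∏ j ∈ Finset.range m, (X - C (ξ ^ j)))
    (hU : U ^ m = 1) (hN : N.map U ≤ N) :
    Nat.card N * ∏ c ∈ Finset.range m, Nat.card (H0rel N U ξ m c ⧸ Srel N U ξ m c) =
      ∏ c ∈ Finset.range m, Nat.card (isoIn N U ξ c) := by
  have telescope (c : ℕ) (hc : c ≤ m) :
      Nat.card (N.map (aeval U (∏ j ∈ Finset.Ico c m, (X - C (ξ ^ j))))) =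
        ∏ d ∈ Finset.range c,
          Nat.card (isoIn N U ξ d ⊓ N.map (tailProd U ξ m d) : Submodule R M) := by
    induction c with
    | zero =>
      rw [← Finset.range_eq_Ico, ← hprod]
      simp [hU]
    | succ c ih =>
      rw [Finset.prod_range_succ, ← ih (by omega)]
      exact card_map_tailProd hN hc
  have hcard := telescope m le_rfl
  simp only [Finset.Ico_self, Finset.prod_empty, map_one, Module.End.one_eq_id,
    Submodule.map_id] at hcard
  rw [hcard, mul_comm, ← Finset.prod_mul_distrib]
  refine Finset.prod_congr rfl fun c hc => ?_
  exact card_H0rel_quotient_Srel_mul_card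
    (map_quasiIdem_le_map_tailProd hprod hN (Finset.mem_range.mp hc))

end Cyclic

section Product

variable {r : ℕ} {n : Fin r → ℕ} {T : Fin r → Module.End R M} {ζ : R} {e : ℕ}

theorem map_psiFix_le (hcomm : ∀ i j, Commute (T i) (T j)) (k : ∀ t, Fin (n t)) (s : ℕ)
    (i : Fin r) : (psiFix n T ζ e k s).map (T i) ≤ psiFix n T ζ e k s := by
  rintro _ ⟨x, hx, rfl⟩
  simp only [psiFix, SetLike.mem_coe, Submodule.mem_iInf, LinearMap.mem_ker] at hx ⊢
  intro t ht
  have hc : Commute (T t - ζ ^ (e / n t * (k t : ℕ)) • (1 : Module.End R M)) (T i) :=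
    (hcomm t i).sub_left ((Commute.one_left _).smul_left _)
  rw [← Module.End.mul_apply, hc.eq, Module.End.mul_apply, hx t ht, map_zero]

theorem psiFix_update_succ (k : ∀ t, Fin (n t)) (s : Fin r) (c : Fin (n s)) :
    psiFix n T ζ e (Function.update k s c) (s + 1) =
      isoIn (psiFix n T ζ e k s) (T s) (ζ ^ (e / n s)) c := by
  ext x
  simp only [psiFix, isoIn, Submodule.mem_inf, Submodule.mem_iInf, ← pow_mul]
  constructor
  · intro h
    refine ⟨fun t ht => ?_, by simpa using h s (Nat.lt_succ_self _)⟩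
    have hne : t ≠ s := fun h => by simp [h] at ht
    simpa [hne] using h t (by omega)
  · rintro ⟨h, hs⟩ t ht
    by_cases hts : t = s
    · subst hts
      simpa using hs
    · have := Fin.val_ne_of_ne hts
      simpa [hts] using h t (by omega)

theorem prod_filter_eq_zero_succ (hn : ∀ i, 1 ≤ n i) {A : Type*} [CommMonoid A] (s : Fin r)
    (f : (∀ t, Fin (n t)) → A) :
    ∏ k ∈ Finset.univ.filter
        (fun k : ∀ t, Fin (n t) => ∀ t : Fin r, (s : ℕ) + 1 ≤ (t : ℕ) → (k t : ℕ) = 0), f k =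
      ∏ k ∈ Finset.univ.filter
        (fun k : ∀ t, Fin (n t) => ∀ t : Fin r, (s : ℕ) ≤ (t : ℕ) → (k t : ℕ) = 0),
        ∏ c : Fin (n s), f (Function.update k s c) := by
  rw [← Finset.prod_product']
  symm
  refine Finset.prod_bij' (fun p _ => Function.update p.1 s p.2)
    (fun k _ => (Function.update k s ⟨0, hn s⟩, k s)) ?_ ?_ ?_ ?_ ?_
  · rintro ⟨k, c⟩ hk
    simp only [Finset.mem_product, Finset.mem_filter, Finset.mem_univ, true_and, and_true] at hk ⊢
    intro t ht
    have hne : t ≠ s := fun h => by simp [h] at ht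
    simpa [hne] using hk t (by omega)
  · intro k hk
    simp only [Finset.mem_product, Finset.mem_filter, Finset.mem_univ, true_and, and_true] at hk ⊢
    intro t ht
    by_cases hts : t = s
    · subst hts
      simp
    · have := Fin.val_ne_of_ne hts
      simpa [hts] using hk t (by omega)
  · rintro ⟨k, c⟩ hk
    simp only [Finset.mem_product, Finset.mem_filter, Finset.mem_univ, true_and, and_true] at hk
    have hs : k s = ⟨0, hn s⟩ := Fin.ext (hk s le_rfl)
    simp [← hs]
  · intro k _
    simp
  · intro p _
    rfl

theorem card_mul_prod_filter_lt [Finite M] (hn : ∀ i, 1 ≤ n i)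
    (hprod : ∀ i, (X ^ n i - 1 : R[X]) =
      ∏ j ∈ Finset.range (n i), (X - C ((ζ ^ (e / n i)) ^ j)))
    (hT : ∀ i, T i ^ n i = 1) (hcomm : ∀ i j, Commute (T i) (T j)) (s : ℕ) (hs : s ≤ r) :
    Nat.card M *
        ∏ i ∈ Finset.univ.filter (fun i : Fin r => (i : ℕ) < s), ∏ c ∈ Finset.range (n i),
          ∏ k ∈ Finset.univ.filter
            (fun k : ∀ t, Fin (n t) => ∀ t : Fin r, (i : ℕ) ≤ (t : ℕ) → (k t : ℕ) = 0),
            Nat.card (H0rel (psiFix n T ζ e k i) (T i) (ζ ^ (e / n i)) (n i) c ⧸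
              Srel (psiFix n T ζ e k i) (T i) (ζ ^ (e / n i)) (n i) c) =
      ∏ k ∈ Finset.univ.filter
        (fun k : ∀ t, Fin (n t) => ∀ t : Fin r, s ≤ (t : ℕ) → (k t : ℕ) = 0),
        Nat.card (psiFix n T ζ e k s) := by
  induction s with
  | zero =>
    have hfilter : Finset.univ.filter
        (fun k : ∀ t, Fin (n t) => ∀ t : Fin r, 0 ≤ (t : ℕ) → (k t : ℕ) = 0) =
          {fun t => ⟨0, hn t⟩} := by
      ext k
      simp [funext_iff, Fin.ext_iff]
    rw [hfilter]
    simp [psiFix]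
  | succ s ih =>
    have hinsert : Finset.univ.filter (fun i : Fin r => (i : ℕ) < s + 1) =
        insert ⟨s, hs⟩ (Finset.univ.filter (fun i : Fin r => (i : ℕ) < s)) := by
      ext i
      simp only [Finset.mem_filter, Finset.mem_univ, true_and, Finset.mem_insert, Fin.ext_iff]
      omega
    rw [hinsert, Finset.prod_insert (by simp), mul_left_comm, ih (by omega), Finset.prod_comm,
      ← Finset.prod_mul_distrib, prod_filter_eq_zero_succ hn ⟨s, hs⟩]
    refine Finset.prod_congr rfl fun k _ => ?_
    rw [mul_comm, card_mul_prod_card_H0rel_quotient_Srel (hprod _) (hT _)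
      (map_psiFix_le hcomm k s _), Finset.prod_range]
    exact Finset.prod_congr rfl fun c _ => by
      rw [← psiFix_update_succ (s := ⟨s, hs⟩)]

end Product

/-- **Theorem 3.1.** Let `G = H_1 × ⋯ × H_r` (`r ≥ 1`) be a finite abelian group, a direct
product of cyclic groups `H_i` of order `n i` with generators `τ_i` (encoded as pairwise
commuting `R`-linear endomorphisms `T i` of `M` with `(T i)^{n i} = 1`), let `e` be the
exponent of `G` (the lcm of the `n i`), let `R` contain a root `ζ` of the `e`-th cyclotomic
polynomial, and let `M` be a finite `R[G]`-module.  Then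
`[M] ⬝ ∏_{i=1}^r ∏_{χ ∈ Ĥ_i} ∏_{ψ ∈ Ĝ_{i-1}} [Ĥ⁰_χ(H_i, M^ψ)/S_χ(M^ψ)] = ∏_{χ ∈ Ĝ} [M^χ]`,
where `Ĝ_{i-1}` is identified with the set of character indices `k` with `k t = 0` for
`t ≥ i`. -/
theorem order_mul_prod_H0_div_S_eq_prod_isotypic_abelian
    (r : ℕ) (hr : 1 ≤ r) (n : Fin r → ℕ) (hn : ∀ i, 1 ≤ n i)
    (R : Type*) [CommRing R] (ζ : R)
    (hζ : Polynomial.aeval ζ (Polynomial.cyclotomic (Finset.univ.lcm n) ℤ) = 0)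
    (M : Type*) [AddCommGroup M] [Module R M] [Finite M]
    (T : Fin r → Module.End R M) (hT : ∀ i, T i ^ n i = 1)
    (hcomm : ∀ i j, Commute (T i) (T j)) :
    Nat.card M *
        ∏ i : Fin r, ∏ c ∈ Finset.range (n i),
          ∏ k ∈ Finset.univ.filter
            (fun k : ∀ t, Fin (n t) => ∀ t : Fin r, (i : ℕ) ≤ (t : ℕ) → (k t : ℕ) = 0),
            Nat.card
              (H0rel (psiFix n T ζ (Finset.univ.lcm n) k (i : ℕ)) (T i)
                  (ζ ^ (Finset.univ.lcm n / n i)) (n i) c ⧸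
                Srel (psiFix n T ζ (Finset.univ.lcm n) k (i : ℕ)) (T i)
                  (ζ ^ (Finset.univ.lcm n / n i)) (n i) c) =
      ∏ k : ∀ t, Fin (n t), Nat.card (psiFix n T ζ (Finset.univ.lcm n) k r) := by
  have hprod (i : Fin r) : (X ^ n i - 1 : R[X]) =
      ∏ j ∈ Finset.range (n i), (X - C ((ζ ^ (Finset.univ.lcm n / n i)) ^ j)) :=
    X_pow_sub_one_eq_prod_range_of_aeval_cyclotomic
      (Nat.pos_of_ne_zero fun h => by
        obtain ⟨i, -, hi⟩ := Finset.lcm_eq_zero_iff.mp h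
        exact absurd (hn i) (by omega))
      hζ (Finset.dvd_lcm (Finset.mem_univ i))
  have hpos (t : Fin r) : ¬ r ≤ (t : ℕ) := by omega
  simpa [hpos] using card_mul_prod_filter_lt hn hprod hT hcomm r le_rfl
end
end

section
/- Let G = K_1 × ⋯ × K_r be a finite abelian group written as a direct product of cyclic groups K_i of prime-power order p_i^{a_i} (a_i ≥ 1, the primes p_i not necessarily distinct) with fixed generators τ_i, let e be the exponent of G, let R be a commutative ring containing an element ζ that is a root of the e-th cyclotomic polynomial over ℤ, and let M be a finite R[G]-module. For 0 ≤ i ≤ r-1 set G_i = K_1 × ⋯ × K_i (with G_0 trivial), and for 1 ≤ i ≤ r let H_i be the unique subgroup of K_i of order p_i. Assume that Ĥ⁰_χ(H_i, M^ψ) = 0 for all 1 ≤ i ≤ r, all R-valued characters χ of H_i, and all characters ψ ∈ Ĝ_{i-1}. Then [M] = ∏_{ψ ∈ Ĝ} [M^ψ] = ∏_{ψ ∈ Ĝ} [ε_ψ M], where ε_ψ = Σ_{σ∈G} ψ(σ)^{-1} σ. -/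
noncomputable section

open Polynomial

variable {R : Type*} [CommRing R] {M : Type*} [AddCommGroup M] [Module R M]

/-- The group element `σ = τ_1^{σ_1} ⋯ τ_r^{σ_r}` of `G = K_1 × ⋯ × K_r` acting on `M`
through the commuting endomorphisms `T t`. -/
def prodPow {r : ℕ} (n : Fin r → ℕ) (T : Fin r → Module.End R M)
    (hcomm : ∀ i j, Commute (T i) (T j)) (σ : ∀ t, Fin (n t)) : Module.End R M :=
  Finset.univ.noncommProd (fun t => T t ^ (σ t : ℕ))
    (fun t _ t' _ _ => Commute.pow_pow (hcomm t t') _ _)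

/-- The quasi-idempotent `ε_ψ = ∑_{σ ∈ G} ψ(σ)⁻¹ σ` of the full character `ψ` of
`G = K_1 × ⋯ × K_r` with `ψ(τ_t) = (ζ^{e/n_t})^{k t}`, acting on `M`
(with `ψ(σ)⁻¹ = ∏_t ξ_t^{(n_t-1)·k_t·σ_t}` since `ξ_t^{n_t} = 1`). -/
def epsFull {r : ℕ} (n : Fin r → ℕ) (T : Fin r → Module.End R M)
    (hcomm : ∀ i j, Commute (T i) (T j)) (ζ : R) (e : ℕ) (k : ∀ t, Fin (n t)) :
    Module.End R M :=
  ∑ σ : ∀ t, Fin (n t),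
    (∏ t, ζ ^ (e / n t * ((n t - 1) * ((k t : ℕ) * (σ t : ℕ))))) • prodPow n T hcomm σ

/-- A root of `Φ_e` in a commutative ring is an `e`-th root of unity whose powers split `X ^ m - 1`
for every `m ∣ e`. -/
theorem X_pow_sub_one_eq_prod_of_aeval_cyclotomic {R : Type*} [CommRing R] {ζ : R} {e m : ℕ}
    (he : e ≠ 0) (hζ : aeval ζ (cyclotomic e ℤ) = 0) (hm : m ∣ e) :
    (X ^ m - 1 : R[X]) = ∏ j ∈ Finset.range m, (X - C ((ζ ^ (e / m)) ^ j)) := by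
  have hirr := cyclotomic.irreducible (Nat.pos_of_ne_zero he)
  have : Fact (Irreducible (cyclotomic e ℤ)) := ⟨hirr⟩
  have hprime : Prime (cyclotomic e ℤ) := UniqueFactorizationMonoid.irreducible_iff_prime.1 hirr
  have : IsDomain (AdjoinRoot (cyclotomic e ℤ)) := AdjoinRoot.isDomain_of_prime hprime
  have hdeg : (cyclotomic e ℤ).degree ≠ 0 :=
    (degree_cyclotomic_pos e ℤ (Nat.pos_of_ne_zero he)).ne'
  have : CharZero (AdjoinRoot (cyclotomic e ℤ)) :=
    charZero_of_injective_ringHom (AdjoinRoot.of.injective_of_degree_ne_zero hdeg)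
  have : NeZero (e : AdjoinRoot (cyclotomic e ℤ)) := ⟨Nat.cast_ne_zero.2 he⟩
  have hprim : IsPrimitiveRoot (AdjoinRoot.root (cyclotomic e ℤ)) e := by
    rw [← isRoot_cyclotomic_iff]
    have h := AdjoinRoot.isRoot_root (cyclotomic e ℤ)
    rwa [map_cyclotomic] at h
  have hm0 : 0 < m := Nat.pos_of_dvd_of_pos hm (Nat.pos_of_ne_zero he)
  have hprim' := hprim.pow (Nat.pos_of_ne_zero he) (Nat.div_mul_cancel hm).symm
  have key : (X ^ m - 1 : (AdjoinRoot (cyclotomic e ℤ))[X]) =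
      ∏ j ∈ Finset.range m, (X - C ((AdjoinRoot.root (cyclotomic e ℤ) ^ (e / m)) ^ j)) := by
    classical
    rw [X_pow_sub_one_eq_prod hm0 hprim']
    have : nthRootsFinset m (1 : AdjoinRoot (cyclotomic e ℤ)) =
        (Finset.range m).image fun j => (AdjoinRoot.root (cyclotomic e ℤ) ^ (e / m)) ^ j := by
      ext x
      rw [mem_nthRootsFinset hm0, Finset.mem_image]
      constructor
      · intro hx
        have : NeZero m := ⟨hm0.ne'⟩
        obtain ⟨i, hi, hix⟩ := hprim'.eq_pow_of_pow_eq_one hx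
        exact ⟨i, Finset.mem_range.2 hi, hix⟩
      · rintro ⟨j, -, rfl⟩
        rw [← pow_mul, mul_comm, pow_mul, hprim'.pow_eq_one, one_pow]
    rw [this, Finset.prod_image]
    intro i hi j hj hij
    exact hprim'.pow_inj (Finset.mem_range.1 hi) (Finset.mem_range.1 hj) hij
  obtain ⟨φ, hφ⟩ : ∃ φ : AdjoinRoot (cyclotomic e ℤ) →+* R, φ (AdjoinRoot.root _) = ζ :=
    ⟨AdjoinRoot.lift (Int.castRingHom R) ζ (by simpa [aeval_def] using hζ), AdjoinRoot.lift_root _⟩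
  simpa [Polynomial.map_prod, hφ] using congrArg (Polynomial.map φ) key

theorem card_inf_ker_mul_card_map [Finite M] (N : Submodule R M) (f : Module.End R M) :
    Nat.card ↥(N ⊓ LinearMap.ker f) * Nat.card ↥(N.map f) = Nat.card N := by
  rw [Submodule.card_eq_card_quotient_mul_card (LinearMap.ker (f.domRestrict N)),
    Nat.card_congr (f.domRestrict N).quotKerEquivRange.toEquiv, LinearMap.range_domRestrict,
    LinearMap.ker_domRestrict, ← Submodule.map_comap_subtype]
  congr 1
  exact Nat.card_congr
    (Submodule.equivMapOfInjective N.subtype N.injective_subtype _).symm.toEquiv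

theorem eq_of_le_of_card_le [Finite M] {N N' : Submodule R M} (h : N ≤ N')
    (hcard : Nat.card N' ≤ Nat.card N) : N = N' :=
  Submodule.toAddSubgroup_injective (AddSubgroup.eq_of_le_of_card_ge (H := N.toAddSubgroup)
    (K := N'.toAddSubgroup) h hcard)

theorem geom_sum_pow_mul_geom_sum {A : Type*} [Semiring A] (x : A) (p q : ℕ) :
    (∑ j ∈ Finset.range p, (x ^ q) ^ j) * ∑ i ∈ Finset.range q, x ^ i =
      ∑ j ∈ Finset.range (p * q), x ^ j := by
  induction p with
  | zero => simp
  | succ p ih =>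
    rw [Finset.sum_range_succ, add_mul, ih, Nat.succ_mul, Finset.sum_range_add, Finset.mul_sum]
    congr 1
    refine Finset.sum_congr rfl fun i _ => ?_
    rw [← pow_mul, ← pow_add, mul_comm q p]

theorem aeval_apply_mem_of_invariant {N : Submodule R M} {U : Module.End R M}
    (hN : ∀ x ∈ N, U x ∈ N) (f : R[X]) {x : M} (hx : x ∈ N) : aeval U f x ∈ N := by
  induction f using Polynomial.induction_on' generalizing x with
  | add f g hf hg => simpa using N.add_mem (hf hx) (hg hx)
  | monomial k c =>
    rw [aeval_monomial, ← Algebra.smul_def, LinearMap.smul_apply]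
    refine N.smul_mem _ ?_
    induction k with
    | zero => simpa
    | succ k ih => rw [pow_succ', Module.End.mul_apply]; exact hN _ ih

theorem pow_apply_eq_self {W : Module.End R M} {x : M} (h : W x = x) (i : ℕ) : (W ^ i) x = x := by
  induction i with
  | zero => simp
  | succ i ih => rw [pow_succ, Module.End.mul_apply, h, ih]

/-- If the subgroup of order `p` of a cyclic group of order `p ^ (b + 1)` generated by `W` has
trivial `Ĥ⁰` with values in the finite module `N`, then so has the whole group. -/
theorem inf_ker_le_map_geom_sum [Finite M] {N : Submodule R M} {W : Module.End R M}
    (hN : ∀ x ∈ N, W x ∈ N) {p b : ℕ} (hW : W ^ (p ^ (b + 1)) = 1)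
    (h : N ⊓ LinearMap.ker (W ^ p ^ b - 1) ≤
      N.map (∑ j ∈ Finset.range p, (W ^ p ^ b) ^ j)) :
    N ⊓ LinearMap.ker (W - 1) ≤ N.map (∑ j ∈ Finset.range (p ^ (b + 1)), W ^ j) := by
  set V := W ^ p ^ b with hV
  set F := ∑ j ∈ Finset.range p, V ^ j with hF
  set S := ∑ i ∈ Finset.range (p ^ b), W ^ i with hS
  have hFS : F * S = ∑ j ∈ Finset.range (p ^ (b + 1)), W ^ j := by
    rw [hF, hV, hS, geom_sum_pow_mul_geom_sum, pow_succ']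
  have hVp : V ^ p = 1 := by rw [hV, ← pow_mul, ← pow_succ, hW]
  have hpow : ∀ i, ∀ x ∈ N, (W ^ i) x ∈ N := fun i x hx => by
    simpa using aeval_apply_mem_of_invariant hN (X ^ i) hx
  have hSN : ∀ x ∈ N, S x ∈ N := fun x hx => by
    rw [hS, LinearMap.sum_apply]; exact N.sum_mem fun i _ => hpow i x hx
  have hFN : ∀ x ∈ N, F x ∈ N := fun x hx => by
    rw [hF, LinearMap.sum_apply]
    exact N.sum_mem fun i _ => by rw [hV, ← pow_mul]; exact hpow _ x hx
  have hVF : (V - 1) * F = 0 := by rw [hF, mul_geom_sum, hVp, sub_self]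
  have hFV : F * (V - 1) = 0 := by rw [hF, geom_sum_mul, hVp, sub_self]
  have hWS : (W - 1) * S = V - 1 := by rw [hS, mul_geom_sum]
  have heq : N ⊓ LinearMap.ker (V - 1) = N.map F := by
    refine le_antisymm h ?_
    rintro _ ⟨y, hy, rfl⟩
    refine ⟨hFN y hy, ?_⟩
    rw [SetLike.mem_coe, LinearMap.mem_ker, ← Module.End.mul_apply, hVF, LinearMap.zero_apply]
  have hle : N.map (V - 1) ≤ N ⊓ LinearMap.ker F := by
    rintro _ ⟨y, hy, rfl⟩
    refine ⟨?_, ?_⟩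
    · rw [LinearMap.sub_apply]
      exact N.sub_mem (hpow _ y hy) hy
    · rw [SetLike.mem_coe, LinearMap.mem_ker, ← Module.End.mul_apply, hFV, LinearMap.zero_apply]
  have hker : N.map (V - 1) = N ⊓ LinearMap.ker F := by
    refine eq_of_le_of_card_le hle (le_of_eq ?_)
    have h1 := card_inf_ker_mul_card_map N F
    have h2 := card_inf_ker_mul_card_map N (V - 1)
    rw [heq, mul_comm] at h2
    exact Nat.eq_of_mul_eq_mul_right Nat.card_pos (h1.trans h2.symm)
  have hstep : ∀ x ∈ N, W x = x → ∃ w ∈ N, W w = w ∧ ∃ z ∈ N, x = p • w + (F * S) z := by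
    intro x hx hWx
    have hWi : ∀ i, (W ^ i) x = x := pow_apply_eq_self hWx
    obtain ⟨y, hy, rfl⟩ := h ⟨hx, by simp [hV, hWi]⟩
    have hcomm : F * (W - 1) = (W - 1) * F := by
      have : Commute V W := (Commute.refl W).pow_left _
      exact ((Commute.sum_left _ _ _ fun j _ => this.pow_left j).sub_right
        (Commute.one_right _)).eq
    have hmem : (W - 1) y ∈ N ⊓ LinearMap.ker F := by
      refine ⟨by rw [LinearMap.sub_apply]; exact N.sub_mem (hN y hy) hy, ?_⟩
      rw [SetLike.mem_coe, LinearMap.mem_ker, ← Module.End.mul_apply, hcomm,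
        Module.End.mul_apply, LinearMap.sub_apply, hWx, Module.End.one_apply, sub_self]
    rw [← hker] at hmem
    obtain ⟨z, hz, hzy⟩ := hmem
    rw [← hWS, Module.End.mul_apply] at hzy
    have hw : W (y - S z) = y - S z := by
      have : (W - 1) (y - S z) = 0 := by rw [map_sub, hzy, sub_self]
      rwa [LinearMap.sub_apply, Module.End.one_apply, sub_eq_zero] at this
    have hwi : ∀ i, (W ^ i) (y - S z) = y - S z := pow_apply_eq_self hw
    refine ⟨y - S z, N.sub_mem hy (hSN z hz), hw, z, hz, ?_⟩
    have : F (y - S z) = p • (y - S z) := by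
      rw [hF, LinearMap.sum_apply, Finset.sum_congr rfl fun j _ => by
        rw [hV, ← pow_mul, hwi], Finset.sum_const, Finset.card_range]
    rw [← this, map_sub, Module.End.mul_apply, sub_add_cancel]
  have hiter : ∀ j, ∀ x ∈ N, W x = x →
      ∃ w ∈ N, W w = w ∧ ∃ z ∈ N, x = p ^ j • w + (F * S) z := by
    intro j
    induction j with
    | zero => exact fun x hx hWx => ⟨x, hx, hWx, 0, N.zero_mem, by simp⟩
    | succ j ih =>
      intro x hx hWx
      obtain ⟨w, hw, hWw, z, hz, rfl⟩ := ih x hx hWx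
      obtain ⟨w', hw', hWw', z', hz', rfl⟩ := hstep w hw hWw
      refine ⟨w', hw', hWw', p ^ j • z' + z, N.add_mem (N.nsmul_mem hz' _) hz, ?_⟩
      rw [smul_add, smul_smul, ← pow_succ, map_add, map_nsmul, add_assoc]
  rintro x ⟨hx, hWx⟩
  obtain ⟨w, hw, hWw, z, hz, rfl⟩ := hiter (b + 1) x hx
    (by simpa [sub_eq_zero] using hWx)
  rw [← hFS]
  refine ⟨w + z, N.add_mem hw hz, ?_⟩
  have hwi : ∀ i, (W ^ i) w = w := pow_apply_eq_self hWw
  rw [map_add]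
  congr 1
  rw [hFS, LinearMap.sum_apply, Finset.sum_congr rfl fun j _ => hwi j, Finset.sum_const,
    Finset.card_range]

theorem pow_pred_mul_mul_pow {ξ : R} {m : ℕ} (hm : 0 < m) (hξ : ξ ^ m = 1) (k : ℕ) :
    ξ ^ ((m - 1) * k) * ξ ^ k = 1 := by
  obtain ⟨m, rfl⟩ := Nat.exists_eq_succ_of_ne_zero hm.ne'
  rw [← pow_add, Nat.succ_sub_one, ← Nat.succ_mul, pow_mul, hξ, one_pow]

theorem quasiIdem_eq_geom_sum (U : Module.End R M) (ξ : R) (m k : ℕ) :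
    quasiIdem U ξ m k = ∑ j ∈ Finset.range m, (ξ ^ ((m - 1) * k) • U) ^ j := by
  refine Finset.sum_congr rfl fun j _ => ?_
  rw [_root_.smul_pow, ← pow_mul, mul_assoc]

theorem mem_isoIn {N : Submodule R M} {U : Module.End R M} {ξ : R} {k : ℕ} {x : M} :
    x ∈ isoIn N U ξ k ↔ x ∈ N ∧ U x = ξ ^ k • x := by
  simp [isoIn, sub_eq_zero]

theorem isoIn_eq_inf_ker (N : Submodule R M) (U : Module.End R M) {ξ : R} {m : ℕ} (hm : 0 < m)
    (hξ : ξ ^ m = 1) (k : ℕ) :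
    isoIn N U ξ k = N ⊓ LinearMap.ker (ξ ^ ((m - 1) * k) • U - 1) := by
  have h := pow_pred_mul_mul_pow hm hξ k
  ext x
  rw [mem_isoIn, Submodule.mem_inf, LinearMap.mem_ker, LinearMap.sub_apply, sub_eq_zero,
    LinearMap.smul_apply, Module.End.one_apply]
  refine and_congr_right fun _ => ⟨fun hx => ?_, fun hx => ?_⟩
  · rw [hx, smul_smul, h, one_smul]
  · conv_rhs => rw [← hx]
    rw [smul_smul, mul_comm, h, one_smul]

/-- If `Ĥ⁰_χ(H, N) = 0` for every character of the subgroup `H` of order `p` of a cyclic group `K`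
of order `p ^ (b + 1)`, then `N^χ = ε_χ N` for every character `χ` of `K`. -/
theorem isoIn_eq_map_quasiIdem [Finite M] {N : Submodule R M} {U : Module.End R M}
    (hN : ∀ x ∈ N, U x ∈ N) {p b : ℕ} (hp : 0 < p) (hU : U ^ p ^ (b + 1) = 1) {ξ : R}
    (hξ : ξ ^ p ^ (b + 1) = 1)
    (h : ∀ l < p, Subsingleton (H0rel N (U ^ p ^ b) (ξ ^ p ^ b) p l)) (k : ℕ) :
    isoIn N U ξ k = N.map (quasiIdem U ξ (p ^ (b + 1)) k) := by
  have hn : 0 < p ^ (b + 1) := pow_pos hp _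
  have hξ' : (ξ ^ p ^ b) ^ p = 1 := by rw [← pow_mul, ← pow_succ, hξ]
  rw [isoIn_eq_inf_ker N U hn hξ, quasiIdem_eq_geom_sum]
  set u := ξ ^ ((p ^ (b + 1) - 1) * k) with hu
  have hW : (u • U) ^ p ^ (b + 1) = 1 := by
    rw [_root_.smul_pow, hU, hu, ← pow_mul, mul_comm, pow_mul, hξ, one_pow, one_smul]
  refine le_antisymm (inf_ker_le_map_geom_sum (fun x hx => N.smul_mem _ (hN x hx)) hW ?_) ?_
  · have hl := h (k % p) (Nat.mod_lt _ hp)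
    rw [H0rel, Submodule.Quotient.subsingleton_iff, Submodule.comap_subtype_eq_top,
      isoIn_eq_inf_ker N _ hp hξ', quasiIdem_eq_geom_sum] at hl
    have huq : (ξ ^ p ^ b) ^ ((p - 1) * (k % p)) = u ^ p ^ b := by
      have h1 := pow_pred_mul_mul_pow hp hξ' (k % p)
      have h2 : u ^ p ^ b * (ξ ^ p ^ b) ^ (k % p) = 1 := by
        rw [← pow_eq_pow_mod k hξ', hu, pow_right_comm]
        exact pow_pred_mul_mul_pow hn (by rw [pow_right_comm, hξ, one_pow]) k
      exact left_inv_eq_right_inv h1 (by rw [mul_comm, h2])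
    rwa [huq, ← _root_.smul_pow] at hl
  · rintro _ ⟨y, hy, rfl⟩
    refine ⟨?_, ?_⟩
    · rw [LinearMap.sum_apply]
      refine N.sum_mem fun j _ => ?_
      rw [_root_.smul_pow]
      refine N.smul_mem _ ?_
      simpa using aeval_apply_mem_of_invariant hN (X ^ j) hy
    · rw [SetLike.mem_coe, LinearMap.mem_ker, ← Module.End.mul_apply, mul_geom_sum, hW, sub_self,
        LinearMap.zero_apply]

/-- If `N^χ ⊆ ε_χ N` for every character `χ` of a cyclic group, then `[N] = ∏_χ [N^χ]`. -/
theorem card_eq_prod_card_isoIn [Finite M] {N : Submodule R M} {U : Module.End R M}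
    (hN : ∀ x ∈ N, U x ∈ N) {m : ℕ} (hU : U ^ m = 1) {ξ : R} (hξ : ξ ^ m = 1)
    (hX : (X ^ m - 1 : R[X]) = ∏ j ∈ Finset.range m, (X - C (ξ ^ j)))
    (h : ∀ k < m, isoIn N U ξ k ≤ N.map (quasiIdem U ξ m k)) :
    Nat.card N = ∏ k ∈ Finset.range m, Nat.card (isoIn N U ξ k) := by
  set P : ℕ → R[X] := fun k => ∏ j ∈ Finset.range k, (X - C (ξ ^ j)) with hP
  have hle : ∀ k < m, isoIn N U ξ k ≤ N.map (aeval U (P k)) := by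
    intro k hk
    have hm : 0 < m := by omega
    refine (h k hk).trans ?_
    have hu := pow_pred_mul_mul_pow hm hξ k
    set u := ξ ^ ((m - 1) * k) with hu'
    set Q : R[X] := ∑ j ∈ Finset.range m, (C u * X) ^ j with hQ
    have hum : u ^ m = 1 := by rw [hu', ← pow_mul, mul_comm, pow_mul, hξ, one_pow]
    have hfac : C u * X - 1 = (X - C (ξ ^ k)) * C u := by
      rw [sub_mul, ← C_mul, mul_comm (ξ ^ k), hu, C_1, mul_comm X]
    have hprod : (X - C (ξ ^ k)) * (Q * C u) =
        (X - C (ξ ^ k)) * (P k * ∏ j ∈ Finset.Ico (k + 1) m, (X - C (ξ ^ j))) := by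
      calc (X - C (ξ ^ k)) * (Q * C u) = Q * (C u * X - 1) := by rw [hfac]; ring
        _ = X ^ m - 1 := by rw [hQ, geom_sum_mul, mul_pow, ← C_pow, hum, C_1, one_mul]
        _ = _ := by
          rw [hX, ← Finset.prod_range_mul_prod_Ico _ (Nat.succ_le_of_lt hk),
            Finset.prod_range_succ]
          ring
    have hQP : Q = P k * ((∏ j ∈ Finset.Ico (k + 1) m, (X - C (ξ ^ j))) * C (ξ ^ k)) := by
      rw [← mul_assoc, ← (monic_X_sub_C (ξ ^ k)).isRegular.left hprod, mul_assoc, ← C_mul, hu, C_1,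
        mul_one]
    have hqQ : quasiIdem U ξ m k = aeval U Q := by
      rw [quasiIdem_eq_geom_sum, hQ, map_sum]
      refine Finset.sum_congr rfl fun j _ => ?_
      rw [map_pow, map_mul, aeval_C, aeval_X, ← Algebra.smul_def]
    rw [hqQ, hQP]
    rintro _ ⟨y, hy, rfl⟩
    rw [map_mul, Module.End.mul_apply]
    exact ⟨_, aeval_apply_mem_of_invariant hN _ hy, rfl⟩
  have key : ∀ k ≤ m, Nat.card N =
      (∏ j ∈ Finset.range k, Nat.card (isoIn N U ξ j)) * Nat.card (N.map (aeval U (P k))) := by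
    intro k
    induction k with
    | zero => simp [hP]
    | succ k ih =>
      intro hk
      have hmap : (N.map (aeval U (P k))).map (U - ξ ^ k • (1 : Module.End R M)) =
          N.map (aeval U (P (k + 1))) := by
        rw [← Submodule.map_comp, ← Module.End.mul_eq_comp, hP]
        simp only [Finset.prod_range_succ]
        rw [mul_comm (∏ j ∈ Finset.range k, _), map_mul _ (X - _), map_sub, aeval_X, aeval_C,
          Algebra.algebraMap_eq_smul_one]
      have hiso : N.map (aeval U (P k)) ⊓ LinearMap.ker (U - ξ ^ k • (1 : Module.End R M)) =
          isoIn N U ξ k := by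
        refine le_antisymm (inf_le_inf_right _ ?_) (le_inf (hle k hk) inf_le_right)
        rintro _ ⟨y, hy, rfl⟩
        exact aeval_apply_mem_of_invariant hN _ hy
      rw [ih (by omega), Finset.prod_range_succ, mul_assoc, ← hmap, ← hiso,
        card_inf_ker_mul_card_map]
  have hPm : P m = X ^ m - 1 := hX.symm
  rw [key m le_rfl, hPm]
  simp [hU]

section PsiFix

variable {r : ℕ} {n : Fin r → ℕ} {T : Fin r → Module.End R M} {ζ : R} {e : ℕ}

theorem mem_psiFix {k : ∀ t, Fin (n t)} {s : ℕ} {x : M} :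
    x ∈ psiFix n T ζ e k s ↔
      ∀ t : Fin r, (t : ℕ) < s → T t x = ζ ^ (e / n t * (k t : ℕ)) • x := by
  simp [psiFix, Submodule.mem_iInf, sub_eq_zero]

theorem psiFix_zero (k : ∀ t, Fin (n t)) : psiFix n T ζ e k 0 = ⊤ := by
  ext x
  simp [mem_psiFix]

theorem psiFix_congr {k k' : ∀ t, Fin (n t)} {s : ℕ} (h : ∀ t : Fin r, (t : ℕ) < s → k t = k' t) :
    psiFix n T ζ e k s = psiFix n T ζ e k' s := by
  ext x
  simp only [mem_psiFix]
  exact forall₂_congr fun t ht => by rw [h t ht]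

theorem psiFix_succ (k : ∀ t, Fin (n t)) (i : Fin r) :
    psiFix n T ζ e k (i + 1) = isoIn (psiFix n T ζ e k i) (T i) (ζ ^ (e / n i)) (k i) := by
  ext x
  rw [mem_isoIn, mem_psiFix, mem_psiFix, ← pow_mul]
  refine ⟨fun h => ⟨fun t ht => h t (by omega), h i (by omega)⟩, fun h t ht => ?_⟩
  rcases Nat.lt_succ_iff_lt_or_eq.1 ht with ht | ht
  · exact h.1 t ht
  · obtain rfl := Fin.ext ht
    exact h.2

theorem apply_mem_psiFix (hcomm : ∀ i j, Commute (T i) (T j)) {k : ∀ t, Fin (n t)} {s : ℕ}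
    (i : Fin r) {x : M} (hx : x ∈ psiFix n T ζ e k s) : T i x ∈ psiFix n T ζ e k s := by
  rw [mem_psiFix] at hx ⊢
  intro t ht
  rw [← Module.End.mul_apply, (hcomm t i).eq, Module.End.mul_apply, hx t ht, map_smul]

/-- Multiplicativity of orders along the tower of character groups `Ĝ_0, Ĝ_1, …, Ĝ_r`. -/
theorem card_eq_prod_card_psiFix (hn : ∀ t, 0 < n t)
    (h : ∀ (i : Fin r) (k : ∀ t, Fin (n t)), Nat.card (psiFix n T ζ e k i) =
      ∏ j ∈ Finset.range (n i),
        Nat.card (isoIn (psiFix n T ζ e k i) (T i) (ζ ^ (e / n i)) j)) :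
    Nat.card M = ∏ k : ∀ t, Fin (n t), Nat.card (psiFix n T ζ e k r) := by
  classical
  have key : ∀ s ≤ r, Nat.card M =
      ∏ k ∈ Finset.univ.filter
        (fun k : ∀ t, Fin (n t) => ∀ t : Fin r, s ≤ (t : ℕ) → (k t : ℕ) = 0),
        Nat.card (psiFix n T ζ e k s) := by
    intro s
    induction s with
    | zero =>
      intro _
      have : (Finset.univ.filter
          (fun k : ∀ t, Fin (n t) => ∀ t : Fin r, 0 ≤ (t : ℕ) → (k t : ℕ) = 0)) =
          {fun t => ⟨0, hn t⟩} := by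
        ext k
        simp [funext_iff, Fin.ext_iff]
      rw [this, Finset.prod_singleton, psiFix_zero]
      exact (Nat.card_congr (Submodule.topEquiv (R := R) (M := M)).toEquiv).symm
    | succ s ih =>
      intro hs
      let i : Fin r := ⟨s, hs⟩
      rw [ih (by omega)]
      rw [← Finset.prod_fiberwise_of_maps_to (g := fun k => Function.update k i ⟨0, hn i⟩)
        (s := Finset.univ.filter
          (fun k : ∀ t, Fin (n t) => ∀ t : Fin r, s + 1 ≤ (t : ℕ) → (k t : ℕ) = 0))
        (t := Finset.univ.filter
          (fun k : ∀ t, Fin (n t) => ∀ t : Fin r, s ≤ (t : ℕ) → (k t : ℕ) = 0))]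
      · refine Finset.prod_congr rfl fun k hk => ?_
        rw [Finset.mem_filter] at hk
        rw [show s = (i : ℕ) from rfl, h i k, Finset.prod_range]
        refine Finset.prod_bij (fun j _ => Function.update k i j) ?_ ?_ ?_ ?_
        · intro j _
          rw [Finset.mem_filter, Finset.mem_filter]
          refine ⟨⟨Finset.mem_univ _, fun t ht => ?_⟩, ?_⟩
          · have hti : t ≠ i := fun h => by rw [h] at ht; omega
            rw [Function.update_of_ne hti]
            exact hk.2 t (by simp only [i] at ht; omega)
          · rw [Function.update_idem, Function.update_eq_self_iff]
            exact Fin.ext (hk.2 i le_rfl).symm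
        · intro j _ j' _ hj
          exact Function.update_injective k i hj
        · intro k' hk'
          rw [Finset.mem_filter] at hk'
          exact ⟨k' i, Finset.mem_univ _, by rw [← hk'.2]; simp⟩
        · intro j _
          rw [psiFix_succ, Function.update_self,
            psiFix_congr (k := Function.update k i j) (k' := k)]
          intro t ht
          exact Function.update_of_ne (fun h => by rw [h] at ht; omega) _ _
      · intro k hk
        rw [Finset.mem_filter] at hk ⊢
        refine ⟨Finset.mem_univ _, fun t ht => ?_⟩
        by_cases hti : t = i
        · subst hti; simp
        · rw [Function.update_of_ne hti]
          exact hk.2 t (Nat.lt_of_le_of_ne ht fun h => hti (Fin.ext h.symm))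
  rw [key r le_rfl, Finset.filter_true_of_mem]
  exact fun k _ t ht => absurd t.2 (by omega)

open scoped IsMulCommutative in
/-- `ε_ψ` is the product of the quasi-idempotents of the components of `ψ`, so `M^ψ = ε_ψ M` can
be checked one cyclic factor at a time. -/
theorem psiFix_eq_range_epsFull (hcomm : ∀ i j, Commute (T i) (T j)) (k : ∀ t, Fin (n t))
    (h : ∀ i : Fin r, isoIn (psiFix n T ζ e k i) (T i) (ζ ^ (e / n i)) (k i) =
      (psiFix n T ζ e k i).map (quasiIdem (T i) (ζ ^ (e / n i)) (n i) (k i))) :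
    psiFix n T ζ e k r = LinearMap.range (epsFull n T hcomm ζ e k) := by
  let A := Algebra.adjoin R (Set.range T)
  have : IsMulCommutative A := Algebra.isMulCommutative_adjoin R (by
    rintro _ ⟨i, rfl⟩ _ ⟨j, rfl⟩
    exact (hcomm i j).eq)
  let T' : Fin r → A := fun t => ⟨T t, Algebra.subset_adjoin ⟨t, rfl⟩⟩
  have hT' : ∀ t, A.val (T' t) = T t := fun t => rfl
  let Q : Fin r → A := fun t => ∑ j ∈ Finset.range (n t),
    (ζ ^ (e / n t)) ^ ((n t - 1) * ((k t : ℕ) * j)) • T' t ^ j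
  have hQ : ∀ t, A.val (Q t) = quasiIdem (T t) (ζ ^ (e / n t)) (n t) (k t) := fun t => by
    simp only [Q, map_sum, map_smul, map_pow, hT', quasiIdem]
  have hprodPow : ∀ σ : ∀ t, Fin (n t),
      A.val (∏ t, T' t ^ (σ t : ℕ)) = prodPow n T hcomm σ := fun σ =>
    (congrArg A.val (Finset.noncommProd_eq_prod _ _).symm).trans
      (Finset.map_noncommProd _ _ _ A.val)
  have heps : epsFull n T hcomm ζ e k = A.val (∏ t, Q t) := by
    have : ∀ t, Q t = ∑ j : Fin (n t),
        (ζ ^ (e / n t)) ^ ((n t - 1) * ((k t : ℕ) * (j : ℕ))) • T' t ^ (j : ℕ) := fun t =>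
      Finset.sum_range _
    rw [Finset.prod_congr rfl fun t _ => this t, Finset.prod_univ_sum, Fintype.piFinset_univ,
      map_sum, epsFull]
    refine Finset.sum_congr rfl fun σ _ => ?_
    rw [Finset.prod_smul, map_smul, hprodPow]
    simp only [pow_mul]
  have key : ∀ s ≤ r, psiFix n T ζ e k s =
      LinearMap.range (A.val (∏ t ∈ Finset.univ.filter (fun t : Fin r => (t : ℕ) < s), Q t)) := by
    intro s
    induction s with
    | zero =>
      intro _
      simp only [psiFix_zero, not_lt_zero, Finset.filter_false, Finset.prod_empty, map_one]
      exact LinearMap.range_id.symm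
    | succ s ih =>
      intro hs
      let i : Fin r := ⟨s, hs⟩
      have hfil : Finset.univ.filter (fun t : Fin r => (t : ℕ) < s + 1) =
          insert i (Finset.univ.filter (fun t : Fin r => (t : ℕ) < s)) := by
        ext t
        simp [i, Fin.ext_iff]
        omega
      rw [hfil, Finset.prod_insert (by simp [i]), map_mul, hQ, Module.End.mul_eq_comp,
        LinearMap.range_comp, ← ih (by omega)]
      exact (psiFix_succ k i).trans (h i)
  rw [key r le_rfl, heps, Finset.filter_true_of_mem fun t _ => t.2]

end PsiFix

/-- **Theorem 4.12.** Let `G = K_1 × ⋯ × K_r` be a finite abelian group, a direct product of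
cyclic groups `K_i` of prime power order `(p i)^(a i)` with generators `τ_i` (encoded as
pairwise commuting endomorphisms `T i` with `(T i)^{(p i)^(a i)} = 1`), let `e` be the
exponent of `G`, let `R` contain a root `ζ` of the `e`-th cyclotomic polynomial, and let `M`
be a finite `R[G]`-module.  Let `H_i = ⟨τ_i^{p_i^{a_i-1}}⟩` be the unique subgroup of `K_i`
of order `p i`.  If `Ĥ⁰_χ(H_i, M^ψ) = 0` for all `i`, all characters `χ` of `H_i` and all
`ψ ∈ Ĝ_{i-1}`, then `[M] = ∏_{ψ ∈ Ĝ} [M^ψ] = ∏_{ψ ∈ Ĝ} [ε_ψ M]`. -/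
theorem order_eq_prod_isotypic_abelian_of_H0_eq_zero
    (r : ℕ) (hr : 1 ≤ r) (p a : Fin r → ℕ) (hp : ∀ i, (p i).Prime) (ha : ∀ i, 1 ≤ a i)
    (n : Fin r → ℕ) (hnpa : ∀ i, n i = p i ^ a i)
    (R : Type*) [CommRing R] (ζ : R)
    (hζ : Polynomial.aeval ζ (Polynomial.cyclotomic (Finset.univ.lcm n) ℤ) = 0)
    (M : Type*) [AddCommGroup M] [Module R M] [Finite M]
    (T : Fin r → Module.End R M) (hT : ∀ i, T i ^ n i = 1)
    (hcomm : ∀ i j, Commute (T i) (T j))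
    (hH : ∀ i : Fin r, ∀ l < p i,
      ∀ k ∈ Finset.univ.filter
        (fun k : ∀ t, Fin (n t) => ∀ t : Fin r, (i : ℕ) ≤ (t : ℕ) → (k t : ℕ) = 0),
        Subsingleton
          (H0rel (psiFix n T ζ (Finset.univ.lcm n) k (i : ℕ)) (T i ^ p i ^ (a i - 1))
            (ζ ^ (Finset.univ.lcm n / p i)) (p i) l)) :
    Nat.card M =
        (∏ k : ∀ t, Fin (n t), Nat.card (psiFix n T ζ (Finset.univ.lcm n) k r)) ∧
      Nat.card M =
        ∏ k : ∀ t, Fin (n t),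
          Nat.card (LinearMap.range (epsFull n T hcomm ζ (Finset.univ.lcm n) k)) := by
  set e := Finset.univ.lcm n with he
  have hn : ∀ t, 0 < n t := fun t => by rw [hnpa]; exact pow_pos (hp t).pos _
  have hdvd : ∀ t, n t ∣ e := fun t => Finset.dvd_lcm (Finset.mem_univ t)
  have he0 : e ≠ 0 := by
    rw [he, Ne, Finset.lcm_eq_zero_iff]
    rintro ⟨t, -, ht⟩
    exact (hn t).ne' ht
  have hζe : ζ ^ e = 1 := by
    obtain ⟨f, hf⟩ := cyclotomic.dvd_X_pow_sub_one e ℤ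
    have h := congrArg (aeval ζ) hf
    rwa [map_mul, hζ, zero_mul, map_sub, map_pow, aeval_X, map_one, sub_eq_zero] at h
  have hξ : ∀ t, (ζ ^ (e / n t)) ^ n t = 1 := fun t => by
    rw [← pow_mul, Nat.div_mul_cancel (hdvd t), hζe]
  have hiso : ∀ (i : Fin r) (k : ∀ t, Fin (n t)) (j : ℕ),
      isoIn (psiFix n T ζ e k i) (T i) (ζ ^ (e / n i)) j =
        (psiFix n T ζ e k i).map (quasiIdem (T i) (ζ ^ (e / n i)) (n i) j) := by
    intro i k j
    obtain ⟨b, hb⟩ := Nat.exists_eq_succ_of_ne_zero (Nat.one_le_iff_ne_zero.1 (ha i))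
    have hni : n i = p i ^ (b + 1) := by rw [hnpa, hb]
    have hroot : ζ ^ (e / p i) = (ζ ^ (e / n i)) ^ p i ^ b := by
      obtain ⟨c, hc⟩ := hdvd i
      rw [← pow_mul, hc, Nat.mul_div_cancel_left _ (hn i), hni, pow_succ', mul_assoc,
        Nat.mul_div_cancel_left _ (hp i).pos, mul_comm c]
    let k' : ∀ t, Fin (n t) := fun t => if (t : ℕ) < i then k t else ⟨0, hn t⟩
    have hk' : psiFix n T ζ e k' i = psiFix n T ζ e k i :=
      psiFix_congr fun t ht => if_pos ht
    have hH' : ∀ l < p i, Subsingleton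
        (H0rel (psiFix n T ζ e k i) (T i ^ p i ^ b) ((ζ ^ (e / n i)) ^ p i ^ b) (p i) l) := by
      intro l hl
      have h := hH i l hl k' (Finset.mem_filter.2 ⟨Finset.mem_univ _, fun t ht => by
        simp only [k', if_neg (not_lt.2 ht)]⟩)
      rwa [hk', hroot, hb, Nat.succ_sub_one] at h
    have h := isoIn_eq_map_quasiIdem (fun x hx => apply_mem_psiFix hcomm i hx) (hp i).pos
      (by rw [← hni]; exact hT i) (by rw [← hni]; exact hξ i) hH' j
    rwa [← hni] at h
  have hcard : Nat.card M = ∏ k : ∀ t, Fin (n t), Nat.card (psiFix n T ζ e k r) :=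
    card_eq_prod_card_psiFix hn fun i k =>
      card_eq_prod_card_isoIn (fun x hx => apply_mem_psiFix hcomm i hx) (hT i) (hξ i)
        (X_pow_sub_one_eq_prod_of_aeval_cyclotomic he0 hζ (hdvd i)) fun j _ => (hiso i k j).le
  refine ⟨hcard, hcard.trans (Finset.prod_congr rfl fun k _ => ?_)⟩
  rw [psiFix_eq_range_epsFull hcomm k fun i => hiso i k (k i)]
end
end
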